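/- (Proposition 1) Let N ≥ 2, let ρ be any single-qubit state with entries ρ_{ij} (i,j ∈ {0,1}), let U_{Nq} = |0⟩⟨0| ⊗ I₂^{⊗(N−1)} + |1⟩⟨1| ⊗ σ_x^{⊗(N−1)} on (ℂ²)^{⊗N}, and set ρ' = U_{Nq}(ρ ⊗ (|0⟩⟨0|)^{⊗(N−1)})U_{Nq}ᴴ = Σ_{i,j∈{0,1}} ρ_{ij}|i⟩^{⊗N}⟨j|^{⊗N}. Then the GME-concurrence of ρ' equals the l₁-norm coherence of ρ: C_GME(ρ') = C_{l₁}(ρ) = 2|ρ_{01}|. -/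

import Mathlib

open scoped BigOperators
open Matrix
open scoped ComplexOrder

/-- Combine an assignment of indices on `γ` and one on `γᶜ` into a global index. -/
def mergeIdx {N : ℕ} {dims : Fin N → ℕ} (γ : Finset (Fin N))
    (a : ∀ i : {i // i ∈ γ}, Fin (dims i.1))
    (b : ∀ i : {i // i ∈ γᶜ}, Fin (dims i.1)) : ∀ i, Fin (dims i) := fun i =>
  if h : i ∈ γ then a ⟨i, h⟩ else b ⟨i, Finset.mem_compl.mpr h⟩

/-- The reduced density matrix of the pure state `ψ` on the parties in `γ`
(the parties in `γᶜ` are traced out). -/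
noncomputable def reducedMat {N : ℕ} {dims : Fin N → ℕ} (γ : Finset (Fin N))
    (ψ : (∀ i, Fin (dims i)) → ℂ) :
    Matrix (∀ i : {i // i ∈ γ}, Fin (dims i.1)) (∀ i : {i // i ∈ γ}, Fin (dims i.1)) ℂ :=
  Matrix.of fun a a' => ∑ b : ∀ i : {i // i ∈ γᶜ}, Fin (dims i.1),
    ψ (mergeIdx γ a b) * star (ψ (mergeIdx γ a' b))

/-- All nonempty proper subsets of the parties.  Each bipartition `γ|γ̄` occurs
here as both `γ` and `γ̄`, with equal associated values. -/
def bips (N : ℕ) : Finset (Finset (Fin N)) :=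
  Finset.univ.filter fun γ => γ.Nonempty ∧ γ ≠ Finset.univ

/-- The bipartite concurrence `√(2(1 - Tr ρ_γ²))` of a pure state across the
bipartition `γ|γ̄`. -/
noncomputable def bipConc {N : ℕ} {dims : Fin N → ℕ} (γ : Finset (Fin N))
    (ψ : (∀ i, Fin (dims i)) → ℂ) : ℝ :=
  Real.sqrt (2 * (1 - ((reducedMat γ ψ * reducedMat γ ψ).trace).re))

/-- The GME-concurrence of a pure state: the minimum of the bipartite
concurrence over all bipartitions. -/
noncomputable def gmeConcPure {N : ℕ} {dims : Fin N → ℕ}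
    (ψ : (∀ i, Fin (dims i)) → ℂ) : ℝ :=
  sInf {x | ∃ γ ∈ bips N, x = bipConc γ ψ}

/-- Convex roof extension of a pure-state functional `E` to mixed states. -/
noncomputable def convexRoof {ι : Type*} [Fintype ι] (E : (ι → ℂ) → ℝ)
    (ρ : Matrix ι ι ℂ) : ℝ :=
  sInf {x | ∃ (K : ℕ) (p : Fin K → ℝ) (ψ : Fin K → ι → ℂ),
    (∀ k, 0 < p k) ∧ (∀ k, ∑ t, ‖ψ k t‖ ^ 2 = 1) ∧
    ρ = ∑ k, (Matrix.of fun t s => ((p k : ℂ)) * (ψ k t * star (ψ k s)) : Matrix ι ι ℂ) ∧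
    x = ∑ k, p k * E (ψ k)}

/-- The `l₁`-norm of coherence: the sum of the absolute values of the
off-diagonal entries. -/
noncomputable def Cl1 {d : ℕ} (ρ : Matrix (Fin d) (Fin d) ℂ) : ℝ :=
  ∑ i, ∑ j, if i = j then 0 else ‖ρ i j‖

/-- The generalized GHZ vector `α|0⟩^{⊗N} + β|1⟩^{⊗N}`. -/
noncomputable def ghzVec (N : ℕ) (α β : ℂ) : (Fin N → Fin 2) → ℂ := fun t =>
  if t = 0 then α else if t = 1 then β else 0

section Ghz

variable {N : ℕ}

lemma Pi.one_ne_zero_fin_two {ι : Type*} [Nonempty ι] : (1 : ι → Fin 2) ≠ 0 := fun h =>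
  Fin.zero_ne_one (congrFun h (Classical.arbitrary ι)).symm

lemma eq_const_iff (i₀ : Fin N) (t : Fin N → Fin 2) :
    (∀ i, t i = t i₀) ↔ t = 0 ∨ t = 1 := by
  constructor
  · intro h
    have h01 : t i₀ = 0 ∨ t i₀ = 1 := by omega
    exact h01.imp (fun h0 => funext fun i => (h i).trans h0)
      fun h1 => funext fun i => (h i).trans h1
  · rintro (rfl | rfl) <;> simp

lemma mergeIdx_eq_const_iff (γ : Finset (Fin N)) (a : {i // i ∈ γ} → Fin 2)
    (b : {i // i ∈ γᶜ} → Fin 2) (j : Fin 2) :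
    mergeIdx (dims := fun _ : Fin N => 2) γ a b = (fun _ => j) ↔
      a = (fun _ => j) ∧ b = fun _ => j := by
  constructor
  · intro h
    refine ⟨funext fun i => ?_, funext fun i => ?_⟩
    · have := congrFun h i.1
      simpa [mergeIdx, i.2] using this
    · have := congrFun h i.1
      simpa [mergeIdx, Finset.mem_compl.mp i.2] using this
  · rintro ⟨rfl, rfl⟩
    funext i
    simp [mergeIdx]

lemma ghzVec_mergeIdx (γ : Finset (Fin N)) (α β : ℂ) (a : {i // i ∈ γ} → Fin 2)
    (b : {i // i ∈ γᶜ} → Fin 2) :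
    ghzVec N α β (mergeIdx (dims := fun _ : Fin N => 2) γ a b) =
      if a = 0 ∧ b = 0 then α else if a = 1 ∧ b = 1 then β else 0 := by
  have h0 := mergeIdx_eq_const_iff γ a b 0
  have h1 := mergeIdx_eq_const_iff γ a b 1
  unfold ghzVec
  congr 1
  · exact propext h0
  · congr 1
    exact propext h1

lemma reducedMat_ghzVec {γ : Finset (Fin N)} (hγ : γ.Nonempty) (hγ' : γ ≠ Finset.univ)
    (α β : ℂ) :
    reducedMat (dims := fun _ : Fin N => 2) γ (ghzVec N α β) =
      Matrix.diagonal (Pi.single 0 ((‖α‖ ^ 2 : ℝ) : ℂ) + Pi.single 1 ((‖β‖ ^ 2 : ℝ) : ℂ)) := by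
  have hne : Nonempty {i // i ∈ γ} := hγ.to_subtype
  have hne' : Nonempty {i // i ∈ γᶜ} :=
    (Finset.compl_ne_univ_iff_nonempty γᶜ |>.mp (by rwa [compl_compl])).to_subtype
  have h10 : (1 : {i // i ∈ γ} → Fin 2) ≠ 0 := Pi.one_ne_zero_fin_two
  have h10' : (1 : {i // i ∈ γᶜ} → Fin 2) ≠ 0 := Pi.one_ne_zero_fin_two
  ext a a'
  simp only [reducedMat, Matrix.of_apply, ghzVec_mergeIdx, Matrix.diagonal_apply]
  rw [Fintype.sum_eq_add 0 1 h10'.symm fun b hb => by simp [hb.1, hb.2]]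
  by_cases h : a = a'
  · subst h
    by_cases h0 : a = 0
    · subst h0
      simp [h10.symm, h10', Complex.mul_conj']
    · by_cases h1 : a = 1
      · subst h1
        simp [h10, h10', h10'.symm, Complex.mul_conj']
      · simp [h0, h1]
  · rw [if_neg h]
    have h0 : ¬(a = 0 ∧ a' = 0) := fun h' => h (h'.1.trans h'.2.symm)
    have h1 : ¬(a = 1 ∧ a' = 1) := fun h' => h (h'.1.trans h'.2.symm)
    by_cases ha : a = 0 <;> by_cases ha' : a = 1 <;> simp_all [eq_comm]

lemma bipConc_ghzVec {γ : Finset (Fin N)} (hγ : γ ∈ bips N) {α β : ℂ}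
    (h : ‖α‖ ^ 2 + ‖β‖ ^ 2 = 1) :
    bipConc (dims := fun _ : Fin N => 2) γ (ghzVec N α β) = 2 * (‖α‖ * ‖β‖) := by
  obtain ⟨hne, huniv⟩ := (Finset.mem_filter.mp hγ).2
  have : Nonempty {i // i ∈ γ} := hne.to_subtype
  have htr : ((reducedMat (dims := fun _ : Fin N => 2) γ (ghzVec N α β) *
      reducedMat (dims := fun _ : Fin N => 2) γ (ghzVec N α β)).trace).re =
      (‖α‖ ^ 2) ^ 2 + (‖β‖ ^ 2) ^ 2 := by
    rw [reducedMat_ghzVec hne huniv, Matrix.diagonal_mul_diagonal, Matrix.trace_diagonal]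
    have h10 : (1 : {i // i ∈ γ} → Fin 2) ≠ 0 := Pi.one_ne_zero_fin_two
    simp only [Pi.add_apply, add_mul, mul_add, Finset.sum_add_distrib, Pi.single_apply, ite_mul,
      mul_ite, zero_mul, mul_zero]
    simp [h10, h10.symm]
    norm_cast
    simp
    ring
  rw [bipConc, htr, show 2 * (1 - ((‖α‖ ^ 2) ^ 2 + (‖β‖ ^ 2) ^ 2)) = (2 * (‖α‖ * ‖β‖)) ^ 2 by
    linear_combination (-2) * (‖α‖ ^ 2 + ‖β‖ ^ 2 + 1) * h]
  exact Real.sqrt_sq (by positivity)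

lemma bips_nonempty (hN : 2 ≤ N) : (bips N).Nonempty := by
  refine ⟨{⟨0, by omega⟩}, Finset.mem_filter.mpr ⟨Finset.mem_univ _, by simp, fun h => ?_⟩⟩
  have := congrArg Finset.card h
  rw [Finset.card_singleton, Finset.card_univ, Fintype.card_fin] at this
  omega

lemma gmeConcPure_ghzVec (hN : 2 ≤ N) {α β : ℂ} (h : ‖α‖ ^ 2 + ‖β‖ ^ 2 = 1) :
    gmeConcPure (dims := fun _ : Fin N => 2) (ghzVec N α β) = 2 * (‖α‖ * ‖β‖) := by
  obtain ⟨γ, hγ⟩ := bips_nonempty hN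
  have : {x | ∃ γ ∈ bips N, x = bipConc (dims := fun _ : Fin N => 2) γ (ghzVec N α β)} =
      {2 * (‖α‖ * ‖β‖)} := by
    ext x
    constructor
    · rintro ⟨γ, hγ, rfl⟩
      exact bipConc_ghzVec hγ h
    · rintro rfl
      exact ⟨γ, hγ, (bipConc_ghzVec hγ h).symm⟩
  rw [gmeConcPure, this, csInf_singleton]

lemma sum_norm_sq_ghzVec [NeZero N] (α β : ℂ) :
    ∑ t, ‖ghzVec N α β t‖ ^ 2 = ‖α‖ ^ 2 + ‖β‖ ^ 2 := by
  have h : ∀ t, ‖ghzVec N α β t‖ ^ 2 =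
      (if t = 0 then ‖α‖ ^ 2 else 0) + if t = 1 then ‖β‖ ^ 2 else 0 := by
    intro t
    have h10 : (1 : Fin N → Fin 2) ≠ 0 := Pi.one_ne_zero_fin_two
    by_cases h0 : t = 0
    · simp [ghzVec, h0, h10.symm]
    · by_cases h1 : t = 1
      · simp [ghzVec, h1, h10]
      · simp [ghzVec, h0, h1]
  simp [h, Finset.sum_add_distrib]

/-- The matrix `∑_{i,j} ρ_{ij}|i⟩^{⊗N}⟨j|^{⊗N}`. -/
noncomputable def ghzMatrix (i₀ : Fin N) (ρ : Matrix (Fin 2) (Fin 2) ℂ) :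
    Matrix (Fin N → Fin 2) (Fin N → Fin 2) ℂ :=
  Matrix.of fun t s =>
    if (∀ i, t i = t i₀) ∧ (∀ i, s i = s i₀) then ρ (t i₀) (s i₀) else 0

lemma ghzVec_outer (i₀ : Fin N) (α β : ℂ) (t s : Fin N → Fin 2) :
    ghzVec N α β t * star (ghzVec N α β s) =
      ghzMatrix i₀ (Matrix.of fun i j => ![α, β] i * star (![α, β] j)) t s := by
  have : Nonempty (Fin N) := ⟨i₀⟩
  have h10 : (1 : Fin N → Fin 2) ≠ 0 := Pi.one_ne_zero_fin_two
  simp only [ghzMatrix, Matrix.of_apply, eq_const_iff]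
  by_cases ht : t = 0 ∨ t = 1
  · by_cases hs : s = 0 ∨ s = 1
    · rcases ht with rfl | rfl <;> rcases hs with rfl | rfl <;>
        simp [ghzVec, h10]
    · simp [ghzVec, not_or.mp hs]
  · simp [ghzVec, not_or.mp ht]

/-- In a decomposition of a matrix supported on the GHZ subspace, every vector is supported there. -/
lemma eq_ghzVec_of_decomposition (i₀ : Fin N) {ρ : Matrix (Fin 2) (Fin 2) ℂ} {K : ℕ}
    {p : Fin K → ℝ} {ψ : Fin K → (Fin N → Fin 2) → ℂ} (hp : ∀ k, 0 < p k)
    (h : ghzMatrix i₀ ρ = ∑ k, Matrix.of fun t s => (p k : ℂ) * (ψ k t * star (ψ k s)))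
    (k : Fin K) : ψ k = ghzVec N (ψ k 0) (ψ k 1) := by
  funext t
  by_cases ht : t = 0 ∨ t = 1
  · have : Nonempty (Fin N) := ⟨i₀⟩
    have h10 : (1 : Fin N → Fin 2) ≠ 0 := Pi.one_ne_zero_fin_two
    rcases ht with rfl | rfl <;> simp [ghzVec, h10]
  · have hz := congrFun (congrFun h t) t
    simp only [ghzMatrix, Matrix.of_apply, eq_const_iff, ht, false_and, if_false,
      Matrix.sum_apply] at hz
    have hz' : ∑ k, p k * ‖ψ k t‖ ^ 2 = 0 := by
      have : ∀ k, (p k : ℂ) * (ψ k t * star (ψ k t)) = ((p k * ‖ψ k t‖ ^ 2 : ℝ) : ℂ) := by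
        intro k
        push_cast
        rw [← Complex.mul_conj']
        rfl
      simp only [this] at hz
      exact_mod_cast hz.symm
    have hk := (Finset.sum_eq_zero_iff_of_nonneg fun k _ =>
      mul_nonneg (hp k).le (sq_nonneg ‖ψ k t‖)).mp hz' k (Finset.mem_univ k)
    have : ψ k t = 0 := by simpa [(hp k).ne'] using hk
    simp [ghzVec, not_or.mp ht, this]

/-- A qubit state is a mixture of pure states whose coherences add up to that of the state. -/
lemma exists_optimal_decomposition {ρ : Matrix (Fin 2) (Fin 2) ℂ} (hρ : ρ.PosSemidef)
    (htr : ρ.trace = 1) :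
    ∃ (K : ℕ) (p : Fin K → ℝ) (a b : Fin K → ℂ), (∀ k, 0 < p k) ∧
      (∀ k, ‖a k‖ ^ 2 + ‖b k‖ ^ 2 = 1) ∧
      ρ = ∑ k, (p k : ℂ) • (Matrix.of fun i j => ![a k, b k] i * star (![a k, b k] j)) ∧
      ∑ k, p k * (‖a k‖ * ‖b k‖) = ‖ρ 0 1‖ := by
  obtain ⟨x, hx, hx0⟩ : ∃ x : ℝ, 0 ≤ x ∧ ρ 0 0 = x := by
    have := hρ.diag_nonneg (i := 0)
    exact ⟨(ρ 0 0).re, (Complex.nonneg_iff.mp this).1,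
      Complex.ext rfl (Complex.nonneg_iff.mp this).2.symm⟩
  have hy : ρ 1 1 = ((1 - x : ℝ) : ℂ) := by
    rw [Matrix.trace_fin_two, hx0] at htr
    push_cast
    linear_combination htr
  obtain ⟨z, hz⟩ : ∃ z, ρ 0 1 = z := ⟨_, rfl⟩
  have hz' : ρ 1 0 = star z := by rw [← hz, hρ.isHermitian.apply]
  have hdet : ‖z‖ ^ 2 ≤ x * (1 - x) := by
    have h := hρ.det_nonneg
    rw [Matrix.det_fin_two, hx0, hy, hz, hz', Complex.star_def, Complex.mul_conj'] at h
    have : (0 : ℝ) ≤ x * (1 - x) - ‖z‖ ^ 2 := by exact_mod_cast h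
    linarith
  have hρ' : ρ = !![(x : ℂ), z; star z, ((1 - x : ℝ) : ℂ)] := by
    ext i j
    fin_cases i <;> fin_cases j <;> simp [hx0, hy, hz, hz']
  rw [hz]
  rcases hx.eq_or_lt with rfl | hx
  · have hz0 : z = 0 := by
      have : ‖z‖ ^ 2 = 0 := le_antisymm (by simpa using hdet) (sq_nonneg _)
      simpa using this
    refine ⟨1, ![1], ![0], ![1], by simp, by simp, ?_, by simp [hz0]⟩
    rw [hρ']
    ext i j
    fin_cases i <;> fin_cases j <;> simp [hz0]
  · set r := Real.sqrt (x ^ 2 + ‖z‖ ^ 2)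
    have hr0 : 0 < r := Real.sqrt_pos.mpr (by positivity)
    have hr2 : r ^ 2 = x ^ 2 + ‖z‖ ^ 2 := Real.sq_sqrt (by positivity)
    have hxC : (x : ℂ) ≠ 0 := by exact_mod_cast hx.ne'
    have hrC : (r : ℂ) ≠ 0 := by exact_mod_cast hr0.ne'
    have hn : ‖(x : ℂ) / r‖ = x / r := by
      rw [norm_div, Complex.norm_of_nonneg hx.le, Complex.norm_of_nonneg hr0.le]
    have hn' : ‖star z / r‖ = ‖z‖ / r := by
      rw [norm_div, norm_star, Complex.norm_of_nonneg hr0.le]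
    have hnorm : ‖(x : ℂ) / r‖ ^ 2 + ‖star z / r‖ ^ 2 = 1 := by
      rw [hn, hn']
      field_simp
      exact hr2.symm
    have hcoh : r ^ 2 / x * (‖(x : ℂ) / r‖ * ‖star z / r‖) = ‖z‖ := by
      rw [hn, hn']
      field_simp
    have hmat : ((r ^ 2 / x : ℝ) : ℂ) •
        (Matrix.of fun i j => ![(x : ℂ) / r, star z / r] i * star (![(x : ℂ) / r, star z / r] j)) =
        !![(x : ℂ), z; star z, ((‖z‖ ^ 2 / x : ℝ) : ℂ)] := by
      ext i j
      fin_cases i <;> fin_cases j <;> simp  <;> field_simp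
      rw [mul_comm]
      exact Complex.mul_conj' z
    rcases hdet.eq_or_lt with hd | hd
    · refine ⟨1, ![r ^ 2 / x], ![(x : ℂ) / r], ![star z / r], ?_, ?_, ?_, ?_⟩
      · simp; positivity
      · simpa using hnorm
      · simp only [Fin.sum_univ_one, Matrix.cons_val_zero, hmat, hρ', hd]
        congr! 5
        field_simp
      · simpa using hcoh
    · refine ⟨2, ![r ^ 2 / x, 1 - x - ‖z‖ ^ 2 / x], ![(x : ℂ) / r, 0], ![star z / r, 1],
        ?_, ?_, ?_, ?_⟩
      · have : ‖z‖ ^ 2 / x < 1 - x := by rw [div_lt_iff₀ hx]; linarith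
        simp only [Fin.forall_fin_two, Matrix.cons_val_zero, Matrix.cons_val_one]
        exact ⟨by positivity, by linarith⟩
      · simpa [Fin.forall_fin_two] using hnorm
      · simp only [Fin.sum_univ_two, Matrix.cons_val_zero, Matrix.cons_val_one, hmat, hρ']
        ext i j
        fin_cases i <;> fin_cases j <;> simp 
      · simpa [Fin.sum_univ_two] using hcoh

lemma convexRoof_ghzMatrix (hN : 2 ≤ N) (i₀ : Fin N) {ρ : Matrix (Fin 2) (Fin 2) ℂ}
    (hρ : ρ.PosSemidef) (htr : ρ.trace = 1) :
    convexRoof (gmeConcPure (dims := fun _ : Fin N => 2)) (ghzMatrix i₀ ρ) = 2 * ‖ρ 0 1‖ := by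
  have : NeZero N := ⟨by omega⟩
  refine IsLeast.csInf_eq ⟨?_, ?_⟩
  · obtain ⟨K, p, a, b, hp, hab, hρ', hsum⟩ := exists_optimal_decomposition hρ htr
    refine ⟨K, p, fun k => ghzVec N (a k) (b k), hp, fun k => ?_, ?_, ?_⟩
    · rw [sum_norm_sq_ghzVec, hab]
    · ext t s
      simp only [Matrix.sum_apply, Matrix.of_apply, ghzVec_outer i₀]
      simp only [ghzMatrix, Matrix.of_apply]
      split_ifs
      · conv_lhs => rw [hρ', Matrix.sum_apply]
        rfl
      · simp
    · simp only [gmeConcPure_ghzVec hN (hab _), ← hsum, Finset.mul_sum]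
      exact Finset.sum_congr rfl fun k _ => by ring
  · rintro _ ⟨K, p, ψ, hp, hψ, hdec, rfl⟩
    have hghz := eq_ghzVec_of_decomposition i₀ hp hdec
    have hE : ∀ k, gmeConcPure (dims := fun _ : Fin N => 2) (ψ k) = 2 * (‖ψ k 0‖ * ‖ψ k 1‖) := by
      intro k
      have hk := hψ k
      rw [hghz k, sum_norm_sq_ghzVec] at hk
      conv_lhs => rw [hghz k]
      exact gmeConcPure_ghzVec hN hk
    have h01 : ρ 0 1 = ∑ k, (p k : ℂ) * (ψ k 0 * star (ψ k 1)) := by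
      have := congrFun (congrFun hdec 0) 1
      simpa [ghzMatrix, Matrix.sum_apply] using this
    rw [h01]
    calc 2 * ‖∑ k, (p k : ℂ) * (ψ k 0 * star (ψ k 1))‖
        ≤ 2 * ∑ k, ‖(p k : ℂ) * (ψ k 0 * star (ψ k 1))‖ := by
          gcongr
          exact norm_sum_le _ _
      _ = ∑ k, p k * gmeConcPure (dims := fun _ : Fin N => 2) (ψ k) := by
          rw [Finset.mul_sum]
          refine Finset.sum_congr rfl fun k _ => ?_
          rw [hE, norm_mul, norm_mul, norm_star, Complex.norm_of_nonneg (hp k).le]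
          ring

lemma Cl1_eq_of_isHermitian {ρ : Matrix (Fin 2) (Fin 2) ℂ} (hρ : ρ.IsHermitian) :
    Cl1 ρ = 2 * ‖ρ 0 1‖ := by
  have h : ‖ρ 1 0‖ = ‖ρ 0 1‖ := by rw [← hρ.apply 1 0, norm_star]
  simp [Cl1, Fin.sum_univ_two, h]
  ring

/-- The action of `U_{Nq}` on the product basis. -/
def ctrlFlip (i₀ : Fin N) (s : Fin N → Fin 2) : Fin N → Fin 2 := fun i =>
  if i = i₀ then s i₀ else Equiv.swap 0 (s i₀) (s i)

lemma ctrlFlip_involutive (i₀ : Fin N) : Function.Involutive (ctrlFlip i₀) := by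
  intro s
  funext i
  by_cases hi : i = i₀ <;> simp [ctrlFlip, hi]

lemma eq_ctrlFlip_iff (i₀ : Fin N) (t s : Fin N → Fin 2) :
    (t i₀ = s i₀ ∧ ∀ i, i ≠ i₀ → t i = Equiv.swap 0 (s i₀) (s i)) ↔ s = ctrlFlip i₀ t := by
  rw [← (ctrlFlip_involutive i₀).eq_iff, eq_comm (b := t), funext_iff]
  constructor
  · rintro ⟨h, h'⟩ i
    by_cases hi : i = i₀
    · simp [ctrlFlip, hi, h]
    · simp [ctrlFlip, hi, h' i hi]
  · intro h
    exact ⟨by simpa [ctrlFlip] using h i₀, fun i hi => by simpa [ctrlFlip, hi] using h i⟩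

lemma ctrlFlip_eq_zero_iff (i₀ : Fin N) (t : Fin N → Fin 2) :
    (∀ i, i ≠ i₀ → ctrlFlip i₀ t i = 0) ↔ ∀ i, t i = t i₀ := by
  refine forall_congr' fun i => ?_
  by_cases hi : i = i₀
  · simp [hi]
  · simp [ctrlFlip, hi, Equiv.swap_apply_eq_iff]

end Ghz

/-- Proposition 1: for any single-qubit state `ρ`,
`U_{Nq} = |0⟩⟨0| ⊗ I₂^{⊗(N-1)} + |1⟩⟨1| ⊗ σ_x^{⊗(N-1)}` and
`ρ' = U_{Nq}(ρ ⊗ (|0⟩⟨0|)^{⊗(N-1)})U_{Nq}ᴴ = ∑_{i,j} ρ_{ij}|i⟩^{⊗N}⟨j|^{⊗N}`,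
the GME-concurrence of `ρ'` equals the `l₁`-norm coherence of `ρ`:
`C_GME(ρ') = C_{l₁}(ρ) = 2|ρ₀₁|`. -/
theorem stmt_12 (N : ℕ) (hN : 2 ≤ N)
    (ρ : Matrix (Fin 2) (Fin 2) ℂ) (hρ : ρ.PosSemidef) (htr : ρ.trace = 1) :
    let i₀ : Fin N := ⟨0, by omega⟩
    -- `U_{Nq} = |0⟩⟨0| ⊗ I₂^{⊗(N-1)} + |1⟩⟨1| ⊗ σ_x^{⊗(N-1)}` in the product
    -- basis (`Equiv.swap 0 (s i₀)` is the identity if `s i₀ = 0` and `σ_x` if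
    -- `s i₀ = 1`)
    let U : Matrix (∀ _ : Fin N, Fin 2) (∀ _ : Fin N, Fin 2) ℂ :=
      Matrix.of fun t s =>
        if t i₀ = s i₀ ∧ ∀ i, i ≠ i₀ → t i = Equiv.swap 0 (s i₀) (s i) then 1 else 0
    let ρin : Matrix (∀ _ : Fin N, Fin 2) (∀ _ : Fin N, Fin 2) ℂ :=
      Matrix.of fun t s =>
        if (∀ i, i ≠ i₀ → t i = 0) ∧ (∀ i, i ≠ i₀ → s i = 0)
        then ρ (t i₀) (s i₀) else 0
    let ρ' : Matrix (∀ _ : Fin N, Fin 2) (∀ _ : Fin N, Fin 2) ℂ := U * ρin * Uᴴ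
    (ρ' = (Matrix.of fun t s =>
        if (∀ i, t i = t i₀) ∧ (∀ i, s i = s i₀) then ρ (t i₀) (s i₀) else 0 :
        Matrix (∀ _ : Fin N, Fin 2) (∀ _ : Fin N, Fin 2) ℂ)) ∧
    convexRoof (gmeConcPure (dims := fun _ : Fin N => 2)) ρ' = Cl1 ρ ∧
    Cl1 ρ = 2 * ‖ρ 0 1‖ := by
  intro i₀ U ρin ρ'
  have hρ' : ρ' = ghzMatrix i₀ ρ := by
    ext t s
    have hU : ∀ t s, U t s = if s = ctrlFlip i₀ t then 1 else 0 := fun t s =>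
      if_congr (eq_ctrlFlip_iff i₀ t s) rfl rfl
    have h : ρ' t s = ρin (ctrlFlip i₀ t) (ctrlFlip i₀ s) := by
      simp [ρ', Matrix.mul_apply, hU]
    rw [h]
    simp only [ρin, ghzMatrix, Matrix.of_apply, ctrlFlip_eq_zero_iff]
    simp [ctrlFlip]
  have hC := Cl1_eq_of_isHermitian hρ.isHermitian
  exact ⟨hρ', by rw [hρ', convexRoof_ghzMatrix hN i₀ hρ htr, hC], hC⟩
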